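/- arXiv:1509.09217 — 3 statements merged into one kernel-verified Lean document; each statement's English description precedes it below -/
import Mathlib

section
/- Suppose there is an injective flat ring homomorphism A → A' such that M' = M ⊗_A A' is a finitely generated projective A'-module. Then the kernel of the canonical map M → M ⊗_A A' (sending m to m ⊗ 1) equals the kernel of the evaluation map ev : M → M**; consequently the torsionless quotient of M is isomorphic to the image of the canonical map M → M ⊗_A A'. -/
open TensorProduct

/-- A linear map from a finitely presented module to a flat module vanishes on every element
annihilated by all linear forms. -/
theorem Module.Flat.apply_eq_zero_of_forall_dual {R P N : Type*} [CommRing R]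
    [AddCommGroup P] [Module R P] [Module.FinitePresentation R P]
    [AddCommGroup N] [Module R N] [Module.Flat R N]
    (g : P →ₗ[R] N) {x : P} (hx : ∀ f : Module.Dual R P, f x = 0) : g x = 0 := by
  obtain ⟨k, a, y, rfl⟩ := Module.Flat.exists_factorization_of_finitePresentation g
  have hax : a x = 0 := Finsupp.ext fun i ↦ hx (Finsupp.lapply i ∘ₗ a)
  simp [hax]

/-- If `A → A'` is an injective flat ring map such that `M' = M ⊗[A] A'` is a finitely
generated projective (= locally free) `A'`-module, then the kernel of the canonical map
`M → M ⊗[A] A'` equals the kernel of the evaluation map `M → M**`; consequently the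
torsionless quotient of `M` (the image of the evaluation map) is isomorphic to the image
of `M → M ⊗[A] A'`. -/
theorem torsionlessQuotient_of_flat_injective (A : Type*) [CommRing A] [IsNoetherianRing A]
    (M : Type*) [AddCommGroup M] [Module A M] [Module.Finite A M]
    (A' : Type*) [CommRing A'] [Algebra A A']
    (hinj : Function.Injective (algebraMap A A'))
    [Module.Flat A A']
    [Module.Finite A' (A' ⊗[A] M)] [Module.Projective A' (A' ⊗[A] M)] :
    LinearMap.ker (TensorProduct.mk A A' M 1) = LinearMap.ker (Module.Dual.eval A M) ∧
      Nonempty (↥(LinearMap.range (Module.Dual.eval A M)) ≃ₗ[A]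
        ↥(LinearMap.range (TensorProduct.mk A A' M 1))) := by
  have hker : LinearMap.ker (TensorProduct.mk A A' M 1) =
      LinearMap.ker (Module.Dual.eval A M) := by
    ext m
    simp only [LinearMap.mem_ker, TensorProduct.mk_apply]
    constructor
    · intro hm
      ext f
      apply hinj
      have := congrArg (fun z ↦ TensorProduct.rid A A' (f.lTensor A' z)) hm
      simpa [Algebra.algebraMap_eq_smul_one] using this
    · intro hm
      have := Module.finitePresentation_of_finite A M
      refine (Module.forall_dual_apply_eq_zero_iff A' _).mp fun g ↦ ?_
      exact Module.Flat.apply_eq_zero_of_forall_dual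
        (g.restrictScalars A ∘ₗ TensorProduct.mk A A' M 1) fun f ↦ LinearMap.congr_fun hm f
  exact ⟨hker, ⟨(Module.Dual.eval A M).quotKerEquivRange.symm ≪≫ₗ
    Submodule.quotEquivOfEq _ _ hker.symm ≪≫ₗ
    (TensorProduct.mk A A' M 1).quotKerEquivRange⟩⟩
end

section
/- Let φ : M → F be a versal map, let P be a flat A-module, and let g : M → P be any A-linear map. Then there exists an A-linear map h : F → P with h ∘ φ = g; that is, every A-linear map from M to a flat A-module factors through the versal map φ. -/
/-- Every `A`-linear map from `M` to a flat `A`-module factors through a versal map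
`φ : M → A^n`. -/
theorem factors_through_versal_of_flat (A : Type*) [CommRing A] [IsNoetherianRing A]
    (M : Type*) [AddCommGroup M] [Module A M] [Module.Finite A M]
    (n : ℕ) (φ : M →ₗ[A] (Fin n → A))
    (hφ : Function.Surjective (fun ψ : (Fin n → A) →ₗ[A] A => ψ ∘ₗ φ))
    (P : Type*) [AddCommGroup P] [Module A P] [Module.Flat A P]
    (g : M →ₗ[A] P) :
    ∃ h : (Fin n → A) →ₗ[A] P, h ∘ₗ φ = g := by
  have : Module.FinitePresentation A M := Module.finitePresentation_of_finite A M
  obtain ⟨k, a, y, rfl⟩ := Module.Flat.exists_factorization_of_finitePresentation g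
  choose ψ hψ using fun i : Fin k => hφ (Finsupp.lapply i ∘ₗ a)
  refine ⟨y ∘ₗ (Finsupp.linearEquivFunOnFinite A A (Fin k)).symm ∘ₗ LinearMap.pi ψ, ?_⟩
  ext m
  refine congrArg y (Finsupp.ext fun i => ?_)
  exact LinearMap.congr_fun (hψ i) m
end

section
/- Let φ : M → F be a versal map, let R(M) = im(Sym(φ)) ⊆ Sym_A(F), and for an ideal 𝔭 of A let 𝔭' = (𝔭 · Sym_A(F)) ∩ R(M) denote the contraction to R(M) of the extension of 𝔭 to Sym_A(F). Then the assignment 𝔭 ↦ 𝔭' defines a bijection from the set of associated primes of A (as a module over itself) onto the set of associated primes of the ring R(M) (as a module over itself). -/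
/-- The relation on the tensor algebra whose quotient is the symmetric algebra. -/
inductive SymRel (A : Type*) [CommRing A] (M : Type*) [AddCommGroup M] [Module A M] :
    TensorAlgebra A M → TensorAlgebra A M → Prop
  | mul_comm (x y : M) :
      SymRel A M (TensorAlgebra.ι A x * TensorAlgebra.ι A y)
        (TensorAlgebra.ι A y * TensorAlgebra.ι A x)

/-- The symmetric algebra `Sym_A(M)`: the quotient of the tensor algebra of `M` by the
relation making products of degree-one elements commute. -/
abbrev SymmAlg (A : Type*) [CommRing A] (M : Type*) [AddCommGroup M] [Module A M] :=
  RingQuot (SymRel A M)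

/-- The `A`-linear inclusion of `A^n` into `A[X_1,…,X_n]` as degree-one polynomials,
identifying `A[X_1,…,X_n]` with the symmetric algebra `Sym_A(A^n)`. -/
noncomputable def linMv (A : Type*) [CommRing A] (n : ℕ) :
    (Fin n → A) →ₗ[A] MvPolynomial (Fin n) A :=
  ∑ i : Fin n, LinearMap.smulRight (LinearMap.proj i) (MvPolynomial.X i)

/-- `Sym(φ) : Sym_A(M) → Sym_A(A^n) = A[X_1,…,X_n]`, the algebra map on symmetric
algebras induced by a linear map `φ : M → A^n`. -/
noncomputable def symMap {A : Type*} [CommRing A] {M : Type*} [AddCommGroup M] [Module A M]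
    {n : ℕ} (φ : M →ₗ[A] (Fin n → A)) : SymmAlg A M →ₐ[A] MvPolynomial (Fin n) A :=
  RingQuot.liftAlgHom A ⟨TensorAlgebra.lift A ((linMv A n) ∘ₗ φ), by
    rintro x y ⟨a, b⟩
    simp only [map_mul, TensorAlgebra.lift_ι_apply]
    exact mul_comm _ _⟩

/-- If the annihilator of a polynomial `f` in the coefficient ring is a prime `p`, then some
nonzero multiple `C s * f` has all its nonzero coefficients annihilated by no element outside
`p`. -/
theorem MvPolynomial.exists_C_mul_of_annihilator_eq_prime {σ A : Type*} [CommRing A]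
    {p : Ideal A} [p.IsPrime] {f : MvPolynomial σ A} (hf : ∀ a, a ∈ p ↔ C a * f = 0) :
    ∃ s, C s * f ≠ 0 ∧ ∀ m t, t * coeff m (C s * f) = 0 → coeff m (C s * f) = 0 ∨ t ∈ p := by
  classical
  have key (m : σ →₀ ℕ) : ∃ s ∉ p,
      s * coeff m f = 0 ∨ ∀ t, t * coeff m f = 0 → t ∈ p := by
    by_cases h : ∃ t ∉ p, t * coeff m f = 0
    · obtain ⟨t, ht, h0⟩ := h
      exact ⟨t, ht, .inl h0⟩
    · push Not at h
      exact ⟨1, p.one_notMem, .inr fun t ht => by_contra fun h' => h t h' ht⟩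
  choose s hs hsf using key
  have hS : ∏ m ∈ f.support, s m ∉ p := fun h => by
    obtain ⟨m, -, hm⟩ := (Ideal.IsPrime.prod_mem_iff).1 h
    exact hs m hm
  refine ⟨∏ m ∈ f.support, s m, fun h => hS ((hf _).2 h), fun m t ht => ?_⟩
  rw [coeff_C_mul] at ht ⊢
  by_cases hm : m ∈ f.support
  · rcases hsf m with h | h
    · left
      rw [← Finset.prod_erase_mul _ _ hm, mul_assoc, h, mul_zero]
    · right
      rw [← mul_assoc] at ht
      exact (Ideal.IsPrime.mem_or_mem ‹_› (h _ ht)).resolve_right hS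
  · left
    rw [notMem_support_iff.1 hm, mul_zero]

/-- If the annihilator of a polynomial in the coefficient ring is a prime, then it is the
annihilator of some element of the coefficient ring. -/
theorem MvPolynomial.exists_annihilator_eq_of_annihilator_eq_prime {σ A : Type*} [CommRing A]
    {p : Ideal A} [p.IsPrime] {f : MvPolynomial σ A} (hf : ∀ a, a ∈ p ↔ C a * f = 0) :
    ∃ x : A, ∀ a, a ∈ p ↔ a * x = 0 := by
  obtain ⟨s, hne, hs⟩ := exists_C_mul_of_annihilator_eq_prime hf
  obtain ⟨m, hm⟩ := ne_zero_iff.1 hne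
  refine ⟨coeff m (C s * f), fun a => ⟨fun ha => ?_, fun ha => (hs m a ha).resolve_left hm⟩⟩
  rw [← coeff_C_mul, mul_left_comm, (hf a).1 ha, mul_zero, coeff_zero]

/-- If the annihilator of a polynomial in the coefficient ring is a prime `p`, then its
annihilator in the polynomial ring is the extension of `p`. -/
theorem MvPolynomial.mem_map_C_iff_mul_eq_zero_of_annihilator_eq_prime {n : ℕ} {A : Type*}
    [CommRing A] {p : Ideal A} [p.IsPrime] {f : MvPolynomial (Fin n) A}
    (hf : ∀ a, a ∈ p ↔ C a * f = 0) (h : MvPolynomial (Fin n) A) :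
    h ∈ p.map (C : A →+* MvPolynomial (Fin n) A) ↔ h * f = 0 := by
  classical
  have map_le {g : MvPolynomial (Fin n) A} (hg : g ∈ p.map C) : g * f = 0 := by
    have : p.map C ≤ (⊥ : Ideal (MvPolynomial (Fin n) A)).colon {f} :=
      Ideal.map_le_iff_le_comap.2 fun a ha => by
        simpa [Submodule.mem_colon_singleton] using (hf a).1 ha
    simpa [Submodule.mem_colon_singleton] using this hg
  refine ⟨map_le, fun hh => ?_⟩
  obtain ⟨s, hne, hs⟩ := exists_C_mul_of_annihilator_eq_prime hf
  set h₀ : MvPolynomial (Fin n) A :=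
    ∑ m ∈ h.support with coeff m h ∉ p, monomial m (coeff m h) with hh₀
  have coeff_h₀ (m : Fin n →₀ ℕ) : coeff m h₀ = if coeff m h ∉ p then coeff m h else 0 := by
    rw [hh₀, coeff_sum]
    simp only [coeff_monomial, Finset.sum_ite_eq', Finset.mem_filter, mem_support_iff]
    by_cases h0 : coeff m h = 0 <;> simp [h0]
  have hsub : h - h₀ ∈ p.map (C : A →+* MvPolynomial (Fin n) A) := by
    rw [mem_map_C_iff]
    intro m
    rw [coeff_sub, coeff_h₀]
    split_ifs with hm <;> simp_all
  suffices h₀ = 0 by simpa [this] using hsub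
  by_contra h₀ne
  have h₀f : h₀ * (C s * f) = 0 := by
    have := map_le hsub
    rw [sub_mul, hh, zero_sub, neg_eq_zero] at this
    rw [mul_left_comm, this, mul_zero]
  let o : MonomialOrder (Fin n) := MonomialOrder.lex
  have hlc : o.leadingCoeff h₀ * o.leadingCoeff (C s * f) = 0 := by
    rw [← MonomialOrder.coeff_mul_of_degree_add, h₀f, coeff_zero]
  rcases hs _ _ hlc with h1 | h1
  · exact hne (MonomialOrder.leadingCoeff_eq_zero_iff.1 h1)
  · have h2 : o.leadingCoeff h₀ ≠ 0 := mt MonomialOrder.leadingCoeff_eq_zero_iff.1 h₀ne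
    rw [MonomialOrder.leadingCoeff, coeff_h₀] at h1 h2
    split_ifs at h1 h2 with h3
    · exact h2 rfl
    · exact h3 h1

/-- The Rees algebra of a finite module is a finitely generated algebra. -/
theorem symMap_range_fg {A : Type*} [CommRing A] {M : Type*} [AddCommGroup M] [Module A M]
    [Module.Finite A M] {n : ℕ} (φ : M →ₗ[A] (Fin n → A)) : (symMap φ).range.FG := by
  have hcomp : (symMap φ).comp (RingQuot.mkAlgHom A (SymRel A M)) =
      TensorAlgebra.lift A (linMv A n ∘ₗ φ) := by
    ext x
    simp [symMap]
  have hrange : (symMap φ).range =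
      Algebra.adjoin A (LinearMap.range (linMv A n ∘ₗ φ) : Set (MvPolynomial (Fin n) A)) := by
    rw [LinearMap.coe_range, ← TensorAlgebra.range_lift, ← hcomp, AlgHom.range_comp,
      (AlgHom.range_eq_top _).2 (RingQuot.mkAlgHom_surjective A _), Algebra.map_top]
  obtain ⟨t, ht⟩ := (Module.Finite.iff_fg (N := LinearMap.range (linMv A n ∘ₗ φ))).1 inferInstance
  exact ⟨t, by rw [hrange, ← ht, Algebra.adjoin_span]⟩

/-- The extension of a prime ideal to a polynomial ring is prime. -/
theorem MvPolynomial.isPrime_map_C {σ A : Type*} [CommRing A] {p : Ideal A} (hp : p.IsPrime) :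
    (p.map (C : A →+* MvPolynomial σ A)).IsPrime := by
  have h : p.map (C : A →+* MvPolynomial σ A) =
      RingHom.ker (map (Ideal.Quotient.mk p) : MvPolynomial σ A →+* _) := by
    rw [ker_map, Ideal.mk_ker]
  rw [h]
  exact RingHom.ker_isPrime _

/-- Extension to `A[X_1,…,X_n]` followed by contraction to a noetherian `A`-subalgebra `R` is a
bijection from the associated primes of `A` onto those of `R`. -/
theorem MvPolynomial.associatedPrimes_subalgebra_bijOn {A : Type*} [CommRing A]
    [IsNoetherianRing A] {n : ℕ} (R : Subalgebra A (MvPolynomial (Fin n) A))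
    [IsNoetherianRing R] :
    Set.BijOn
      (fun p : Ideal A => (p.map (algebraMap A (MvPolynomial (Fin n) A))).comap R.val)
      (associatedPrimes A A) (associatedPrimes R R) := by
  refine ⟨fun p hp => ?_, fun p _ q _ hpq => ?_, fun q hq => ?_⟩
  · rw [AssociatedPrimes.mem_iff, isAssociatedPrime_iff] at hp ⊢
    obtain ⟨hp, x, hx⟩ := hp
    have hf (a : A) : a ∈ p ↔ C a * C x = (0 : MvPolynomial (Fin n) A) := by
      rw [← C_mul, C_eq_zero, hx, Submodule.mem_colon_singleton, Submodule.mem_bot, smul_eq_mul]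
    have := isPrime_map_C (σ := Fin n) hp
    refine ⟨Ideal.comap_isPrime (H := this) _, algebraMap A R x, ?_⟩
    ext r
    rw [Submodule.mem_colon_singleton, Submodule.mem_bot, Ideal.mem_comap, algebraMap_eq,
      mem_map_C_iff_mul_eq_zero_of_annihilator_eq_prime hf, Subtype.ext_iff]
    rfl
  · have contract (I : Ideal A) (a : A) :
        algebraMap A R a ∈ (I.map (algebraMap A (MvPolynomial (Fin n) A))).comap R.val ↔
          a ∈ I := by
      rw [Ideal.mem_comap, AlgHom.commutes, algebraMap_eq, mem_map_C_iff]
      refine ⟨fun h => by simpa using h 0, fun h m => ?_⟩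
      rw [coeff_C]
      split_ifs <;> simp [h]
    ext a
    have hpq : (p.map (algebraMap A (MvPolynomial (Fin n) A))).comap R.val =
      (q.map (algebraMap A (MvPolynomial (Fin n) A))).comap R.val := hpq
    rw [← contract p, hpq, contract q]
  · rw [AssociatedPrimes.mem_iff, isAssociatedPrime_iff] at hq
    obtain ⟨hq, f, hqf⟩ := hq
    have hmem (r : R) : r ∈ q ↔ (r : MvPolynomial (Fin n) A) * f = 0 := by
      rw [hqf, Submodule.mem_colon_singleton, Submodule.mem_bot, Subtype.ext_iff]
      rfl
    have hp : (q.comap (algebraMap A R)).IsPrime := Ideal.comap_isPrime _ _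
    have hf (a : A) : a ∈ q.comap (algebraMap A R) ↔
        C a * (f : MvPolynomial (Fin n) A) = 0 := hmem _
    refine ⟨q.comap (algebraMap A R), ?_, ?_⟩
    · rw [AssociatedPrimes.mem_iff, isAssociatedPrime_iff]
      obtain ⟨x, hx⟩ := exists_annihilator_eq_of_annihilator_eq_prime hf
      refine ⟨hp, x, ?_⟩
      ext a
      rw [hx, Submodule.mem_colon_singleton, Submodule.mem_bot, smul_eq_mul]
    · ext r
      rw [hmem, Ideal.mem_comap, algebraMap_eq,
        mem_map_C_iff_mul_eq_zero_of_annihilator_eq_prime hf]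
      rfl

/-- Let `φ : M → A^n` be a versal map and `R(M) = im(Sym(φ)) ⊆ Sym_A(A^n) = A[X_1,…,X_n]`
the Rees algebra of `M`.  The assignment sending an ideal `𝔭` of `A` to the contraction
`𝔭' = (𝔭·A[X_1,…,X_n]) ∩ R(M)` of its extension restricts to a bijection from the set of
associated primes of `A` onto the set of associated primes of `R(M)`. -/
theorem associatedPrimes_reesAlgebra_bijOn
    (A : Type*) [CommRing A] [IsNoetherianRing A]
    (M : Type*) [AddCommGroup M] [Module A M] [Module.Finite A M]
    (n : ℕ) (φ : M →ₗ[A] (Fin n → A))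
    (hφ : Function.Surjective (fun ψ : (Fin n → A) →ₗ[A] A => ψ ∘ₗ φ)) :
    Set.BijOn
      (fun 𝔭 : Ideal A =>
        Ideal.comap (AlgHom.range (symMap φ)).val
          (Ideal.map (algebraMap A (MvPolynomial (Fin n) A)) 𝔭))
      (associatedPrimes A A)
      (associatedPrimes ↥(AlgHom.range (symMap φ)) ↥(AlgHom.range (symMap φ))) := by
  have : IsNoetherianRing (symMap φ).range := isNoetherianRing_of_fg (symMap_range_fg φ)
  exact MvPolynomial.associatedPrimes_subalgebra_bijOn _
end
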